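/- Let X be a finite multiset of positive integers of size n that is δ-dense with δ = 1699200·log(2n)·log²(2μ(X)) and has no α-almost divisor with α = 42480·log(2μ(X)). Then there exist a partition of X into sub-multisets R, A, G (so the multiplicities of R, A, G sum to those of X) and a positive integer s ≤ 42480·μ(X)·Σ(X)·log(2μ(X))/n² such that: (i) {u mod s : u ∈ S(R)} = {0, 1, …, s−1}; (ii) S(A) contains an arithmetic progression P of length 2·mx(X) with step size s and max(P) ≤ 84960·μ(X)·mx(X)·Σ(X)·log(2μ(X))/n²; and (iii) Σ(G) ≥ Σ(X)/2. -/

import Mathlib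

open Multiset

/-- Maximum element of a multiset of naturals (0 if empty). -/
def mxElt (X : Multiset ℕ) : ℕ := X.sup

/-- Maximum multiplicity of a multiset of naturals. -/
def maxMul (X : Multiset ℕ) : ℕ := X.toFinset.sup fun x => X.count x

/-- The set of all subset sums of a multiset. -/
def subsetSums (X : Multiset ℕ) : Set ℕ := {s | ∃ Y ≤ X, Y.sum = s}

/-- `X` is `δ`-dense if `|X|² ≥ δ·μ(X)·mx(X)`. -/
def DenseMS (δ : ℝ) (X : Multiset ℕ) : Prop :=
  δ * maxMul X * mxElt X ≤ (Multiset.card X : ℝ) ^ 2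

/-- `d > 1` is an `α`-almost divisor of `X` if the number of elements of `X` not
divisible by `d` is at most `α·μ(X)·Σ(X)/|X|²`. -/
def AlmostDivisor (α : ℝ) (X : Multiset ℕ) (d : ℕ) : Prop :=
  1 < d ∧ ((Multiset.card (X.filter fun x => ¬ d ∣ x) : ℝ) ≤
    α * maxMul X * X.sum / (Multiset.card X : ℝ) ^ 2)

/-- A multiset is uniform if every element has the maximum multiplicity. -/
def IsUniformMS (X : Multiset ℕ) : Prop := ∀ x ∈ X, X.count x = maxMul X

/-- Number of representations `f_X(z) = μ(X) · #{(x,x') ∈ supp(X)² : x + x' = z}`. -/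
def fX (X : Multiset ℕ) (z : ℕ) : ℕ :=
  maxMul X * ((X.toFinset ×ˢ X.toFinset).filter fun p => p.1 + p.2 = z).card

/-- The bucket `B_{v,X} = {z : f_X(z) ≥ v}`. -/
def bucket (X : Multiset ℕ) (v : ℕ) : Set ℕ := {z | v ≤ fX X z}


open scoped Pointwise in
/-- Among all nonempty subsets of a finite abelian group, the quantity `q |A + C| - p |A|` is
minimised by a subgroup. -/
theorem exists_addSubgroup_minimal_expansion {G : Type*} [AddCommGroup G] [Fintype G]
    [DecidableEq G] (C : Finset G) (p q : ℤ) (hq : 0 ≤ q) :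
    ∃ (H : AddSubgroup G) (F : Finset G), (∀ x, x ∈ F ↔ x ∈ H) ∧
      ∀ A : Finset G, A.Nonempty →
        q * (F + C).card - p * F.card ≤ q * (A + C).card - p * A.card := by
  classical
  set e : Finset G → ℤ := fun A => q * (A + C).card - p * A.card with he
  obtain ⟨M, hM, hMmin⟩ := Finset.exists_min_image
    (Finset.univ.filter fun A : Finset G => A.Nonempty) e ⟨Finset.univ, by simp⟩
  obtain ⟨N, hN, hNmin⟩ := Finset.exists_min_image
    (Finset.univ.filter fun A : Finset G => A.Nonempty ∧ e A ≤ e M) Finset.card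
    ⟨M, by simpa using hM⟩
  simp only [Finset.mem_filter, Finset.mem_univ, true_and] at hM hMmin hN hNmin
  have htrans : ∀ (x : G) (A : Finset G), e (x +ᵥ A) = e A := by
    intro x A
    simp [he, vadd_add_assoc]
  have hsub : ∀ A B : Finset G, e (A ∩ B) + e (A ∪ B) ≤ e A + e B := by
    intro A B
    have h1 : (((A ∩ B).card : ℤ) + (A ∪ B).card) = A.card + B.card := by
      exact_mod_cast Finset.card_inter_add_card_union A B
    have h2 : ((((A + C) ∩ (B + C)).card : ℤ) + ((A + C) ∪ (B + C)).card)
        = (A + C).card + (B + C).card := by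
      exact_mod_cast Finset.card_inter_add_card_union (A + C) (B + C)
    have h3 : (((A ∩ B) + C).card : ℤ) ≤ ((A + C) ∩ (B + C)).card := by
      exact_mod_cast Finset.card_le_card Finset.inter_add_subset
    have h4 : (A ∪ B) + C = (A + C) ∪ (B + C) := Finset.union_add
    simp only [he, h4]
    linear_combination q * h3 + q * h2 - p * h1
  have hdisj : ∀ x y : G, ((x +ᵥ N) ∩ (y +ᵥ N)).Nonempty → x +ᵥ N = y +ᵥ N := by
    intro x y hxy
    have h1 := hsub (x +ᵥ N) (y +ᵥ N)
    rw [htrans, htrans] at h1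
    have h2 := hMmin _ (hxy.mono Finset.inter_subset_union)
    have h3 := hNmin ((x +ᵥ N) ∩ (y +ᵥ N)) ⟨hxy, by linarith [hN.2]⟩
    have h4 := Finset.eq_of_subset_of_card_le (Finset.inter_subset_left (s₁ := x +ᵥ N)
      (s₂ := y +ᵥ N)) (by simpa using h3)
    have h5 := Finset.eq_of_subset_of_card_le (Finset.inter_subset_right (s₁ := x +ᵥ N)
      (s₂ := y +ᵥ N)) (by simpa using h3)
    exact h4.symm.trans h5
  obtain ⟨z, hz⟩ := hN.1
  set F : Finset G := (-z) +ᵥ N with hF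
  have h0 : (0 : G) ∈ F := by
    rw [hF, Finset.mem_vadd_finset]; exact ⟨z, hz, by simp⟩
  have hmem : ∀ x ∈ F, x +ᵥ F = F := by
    intro x hx
    have := hdisj (x + -z) (-z) ⟨x, by
      rw [Finset.mem_inter, add_vadd]
      exact ⟨Finset.mem_vadd_finset.2 ⟨0, h0, by simp⟩, hx⟩⟩
    rwa [add_vadd] at this
  refine ⟨{ carrier := F, zero_mem' := h0, add_mem' := ?_, neg_mem' := ?_ }, F, fun x => Iff.rfl, ?_⟩
  · intro a b ha hb
    have := hmem a ha
    have h : a + b ∈ a +ᵥ F := Finset.mem_vadd_finset.2 ⟨b, hb, rfl⟩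
    rwa [this] at h
  · intro a ha
    have := hmem a ha
    have h : (0 : G) ∈ a +ᵥ F := by rw [this]; exact h0
    obtain ⟨b, hb, hab⟩ := Finset.mem_vadd_finset.1 h
    have : b = -a := by
      rw [vadd_eq_add] at hab
      exact eq_neg_of_add_eq_zero_right hab
    simpa [← this] using hb
  · intro A hA
    have h1 := hMmin A hA
    have h2 : e F = e N := htrans _ _
    change e F ≤ e A
    linarith [hN.2]

open scoped Pointwise in
theorem card_add_expansion {G : Type*} [AddCommGroup G] [Fintype G] [DecidableEq G]
    (C : Finset G) (h0 : 0 ∈ C) (hgen : ∀ H : AddSubgroup G, (∀ c ∈ C, c ∈ H) → H = ⊤)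
    (A : Finset G) (hA : A.Nonempty) :
    C.card * Fintype.card G + 2 * Fintype.card G * A.card ≤
      2 * Fintype.card G * (A + C).card + C.card * A.card := by
  obtain ⟨H, F, hF, hmin⟩ := exists_addSubgroup_minimal_expansion C
    (2 * (Fintype.card G : ℤ) - C.card) (2 * Fintype.card G) (by positivity)
  have h1 := hmin A hA
  have hFC : F ⊆ F + C := fun x hx => Finset.mem_add.2 ⟨x, hx, 0, h0, by simp⟩
  have hCF : C ⊆ F + C := fun x hx =>
    Finset.mem_add.2 ⟨0, (hF 0).2 H.zero_mem, x, hx, by simp⟩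
  have key : (C.card * Fintype.card G : ℤ) ≤
      2 * Fintype.card G * (F + C).card - (2 * (Fintype.card G : ℤ) - C.card) * F.card := by
    by_cases hc : ∀ c ∈ C, c ∈ H
    · have hFu : F = Finset.univ := by
        ext x; simp [hF, hgen H hc]
      have h2 : F + C = Finset.univ := by
        apply Finset.eq_univ_of_forall
        intro x; apply hFC; simp [hFu]
      rw [h2, hFu, Finset.card_univ]
      nlinarith
    · push Not at hc
      obtain ⟨c, hcC, hcH⟩ := hc
      have hd : Disjoint F (c +ᵥ F) := by
        rw [Finset.disjoint_left]
        intro x hx hx'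
        obtain ⟨y, hy, rfl⟩ := Finset.mem_vadd_finset.1 hx'
        apply hcH
        have := H.sub_mem ((hF _).1 hx) ((hF _).1 hy)
        simpa using this
      have hs : F ∪ (c +ᵥ F) ⊆ F + C := by
        apply Finset.union_subset hFC
        intro x hx
        obtain ⟨y, hy, rfl⟩ := Finset.mem_vadd_finset.1 hx
        exact Finset.mem_add.2 ⟨y, hy, c, hcC, by simp [add_comm]⟩
      have h2 : 2 * F.card ≤ (F + C).card := by
        have := Finset.card_le_card hs
        rw [Finset.card_union_of_disjoint hd, Finset.card_vadd_finset] at this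
        omega
      have h3 := Finset.card_le_card hCF
      have h2' : (2 * F.card : ℤ) ≤ (F + C).card := by exact_mod_cast h2
      have h3' : (C.card : ℤ) ≤ (F + C).card := by exact_mod_cast h3
      have h4 : (0 : ℤ) ≤ C.card * F.card := by positivity
      have h5 : (0 : ℤ) ≤ Fintype.card G := by positivity
      nlinarith
  have : (C.card * Fintype.card G + 2 * Fintype.card G * A.card : ℤ) ≤
      2 * Fintype.card G * (A + C).card + C.card * A.card := by linarith
  exact_mod_cast this

open scoped Pointwise in
theorem nsmul_eq_univ_of_generates {G : Type*} [AddCommGroup G] [Fintype G] [DecidableEq G]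
    (C : Finset G) (h0 : 0 ∈ C) (hgen : ∀ H : AddSubgroup G, (∀ c ∈ C, c ∈ H) → H = ⊤)
    (j : ℕ) (hj : 2 * Fintype.card G < j * C.card) : (2 * j) • C = Finset.univ := by
  have hne : ∀ i : ℕ, (i • C).Nonempty := fun i => Finset.Nonempty.nsmul ⟨0, h0⟩
  have grow : ∀ i : ℕ, i * C.card ≤ 4 * (i • C).card ∨ Fintype.card G < 2 * (i • C).card := by
    intro i
    induction i with
    | zero => left; simp
    | succ i ih =>
      have hle : (i • C).card ≤ ((i + 1) • C).card := by
        rw [succ_nsmul]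
        exact Finset.card_le_card fun x hx => Finset.mem_add.2 ⟨x, hx, 0, h0, by simp⟩
      by_cases hbig : Fintype.card G < 2 * (i • C).card
      · right; omega
      · left
        have ih' : i * C.card ≤ 4 * (i • C).card := by tauto
        have h := card_add_expansion C h0 hgen (i • C) (hne i)
        rw [← succ_nsmul] at h
        have hG : 0 < Fintype.card G := Fintype.card_pos
        have h2 : C.card * (2 * (i • C).card) ≤ C.card * Fintype.card G :=
          Nat.mul_le_mul_left _ (by omega)
        have h3 : Fintype.card G * (C.card + 4 * (i • C).card) ≤
            Fintype.card G * (4 * ((i + 1) • C).card) := by nlinarith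
        have h4 := Nat.le_of_mul_le_mul_left h3 hG
        rw [add_mul]
        omega
  have hhalf : Fintype.card G < 2 * (j • C).card := by
    rcases grow j with h | h <;> omega
  apply Finset.eq_univ_of_forall
  intro x
  rw [two_mul, add_nsmul]
  set S := j • C
  have himg : (S.image fun y => x - y).card = S.card :=
    Finset.card_image_of_injective _ (sub_right_injective)
  have : ¬ Disjoint S (S.image fun y => x - y) := by
    intro hd
    have := Finset.card_le_univ (S ∪ S.image fun y => x - y)
    rw [Finset.card_union_of_disjoint hd, himg] at this
    omega
  rw [Finset.not_disjoint_iff] at this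
  obtain ⟨a, ha, hb⟩ := this
  obtain ⟨b, hb, hab⟩ := Finset.mem_image.1 hb
  exact Finset.mem_add.2 ⟨a, ha, b, hb, by rw [← hab]; abel⟩

theorem exists_prime_dvd_of_addSubgroup_ne_top {N : ℕ} [NeZero N] (H : AddSubgroup (ZMod N))
    (hH : H ≠ ⊤) :
    ∃ p : ℕ, p.Prime ∧ p ∣ N ∧ ∀ x : ℕ, (x : ZMod N) ∈ H → p ∣ x := by
  obtain ⟨e, he⟩ := Int.subgroup_cyclic (H.comap (Int.castAddHom (ZMod N)))
  rw [← AddSubgroup.zmultiples_eq_closure] at he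
  have hmem : ∀ x : ℕ, (x : ZMod N) ∈ H → e.natAbs ∣ x := by
    intro x hx
    have : (x : ℤ) ∈ H.comap (Int.castAddHom (ZMod N)) := by simpa using hx
    rw [he, Int.mem_zmultiples_iff] at this
    exact Int.natCast_dvd_natCast.1 ((Int.natAbs_dvd).2 this)
  have hne : e.natAbs ≠ 1 := by
    intro h1
    apply hH
    rw [eq_top_iff]
    intro x _
    have : (x.val : ℤ) ∈ H.comap (Int.castAddHom (ZMod N)) := by
      rw [he, Int.mem_zmultiples_iff, ← Int.natAbs_dvd, h1]; simp
    simpa using this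
  obtain ⟨p, hp, hpe⟩ := Nat.exists_prime_and_dvd hne
  exact ⟨p, hp, hpe.trans (hmem N (by simp)), fun x hx => hpe.trans (hmem x hx)⟩

open scoped Pointwise in
theorem exists_multiset_of_mem_nsmul_image {M : Type*} [AddCommMonoid M] [DecidableEq M]
    (f : ℕ →+ M) (B : Finset ℕ) (j : ℕ) (x : M) (hx : x ∈ j • B.image f) :
    ∃ Y : Multiset ℕ, (∀ y ∈ Y, y ∈ B) ∧ card Y = j ∧ f Y.sum = x := by
  induction j generalizing x with
  | zero => exact ⟨0, by simp, by simp, by simpa [eq_comm] using hx⟩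
  | succ j ih =>
    rw [succ_nsmul, Finset.mem_add] at hx
    obtain ⟨y, hy, z, hz, rfl⟩ := hx
    obtain ⟨Y, hYB, hYc, rfl⟩ := ih y hy
    obtain ⟨b, hb, rfl⟩ := Finset.mem_image.1 hz
    refine ⟨b ::ₘ Y, ?_, by simp [hYc], by simp [add_comm]⟩
    intro y hy
    rcases Multiset.mem_cons.1 hy with rfl | hy
    · exact hb
    · exact hYB y hy

theorem exists_bounded_sum_of_coprime (B : Finset ℕ) (N : ℕ) (hN : N ∈ B)
    (hB : ∀ b ∈ B, 0 < b ∧ b ≤ N) (hgcd : ∀ p : ℕ, p.Prime → ¬ ∀ b ∈ B, p ∣ b)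
    (j : ℕ) (hj : 2 * N < j * B.card) (t w : ℕ) (hw : 2 * j * N ≤ w) (hwt : w ≤ t * N) :
    ∃ Y : Multiset ℕ, (∀ y ∈ Y, y ∈ B) ∧ card Y ≤ 2 * j + t ∧ Y.sum = w := by
  have hN0 : 0 < N := (hB N hN).1
  have : NeZero N := ⟨hN0.ne'⟩
  set f : ℕ →+ ZMod N := (Nat.castAddMonoidHom (ZMod N)) with hf
  have hinj : Set.InjOn f B := by
    intro a ha b hb hab
    have h1 := hB a ha
    have h2 := hB b hb
    have h3 : a ≡ b [MOD N] := (ZMod.natCast_eq_natCast_iff _ _ _).1 (by simpa [hf] using hab)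
    have ha' : (a - 1) ≡ (b - 1) [MOD N] := by
      apply Nat.ModEq.add_right_cancel' 1
      rwa [Nat.sub_add_cancel h1.1, Nat.sub_add_cancel h2.1]
    rw [Nat.ModEq, Nat.mod_eq_of_lt (by omega), Nat.mod_eq_of_lt (by omega)] at ha'
    omega
  have huniv := nsmul_eq_univ_of_generates (B.image f)
    (Finset.mem_image.2 ⟨N, hN, by simp [hf]⟩)
    (fun H hH => by
      by_contra hne
      obtain ⟨p, hp, -, hdvd⟩ := exists_prime_dvd_of_addSubgroup_ne_top H hne
      exact hgcd p hp fun b hb => hdvd b (hH _ (Finset.mem_image_of_mem f hb))) j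
    (by rw [Finset.card_image_of_injOn hinj, ZMod.card]; exact hj)
  obtain ⟨Y, hYB, hYc, hYs⟩ := exists_multiset_of_mem_nsmul_image f B (2 * j) (w : ZMod N)
    (by rw [huniv]; simp)
  have hYle : Y.sum ≤ 2 * j * N := by
    have := Multiset.sum_le_card_nsmul Y N fun y hy => (hB y (hYB y hy)).2
    simpa [hYc] using this
  have hmod : Y.sum ≡ w [MOD N] := (ZMod.natCast_eq_natCast_iff _ _ _).1 (by simpa [hf] using hYs)
  obtain ⟨i, hi⟩ := (Nat.modEq_iff_dvd' (hYle.trans hw)).1 hmod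
  have hit : i ≤ t := by
    have : N * i ≤ N * t := by rw [← hi, mul_comm N t]; omega
    exact Nat.le_of_mul_le_mul_left this hN0
  refine ⟨Y + Multiset.replicate i N, ?_, by simp; omega, ?_⟩
  · intro y hy
    rcases Multiset.mem_add.1 hy with hy | hy
    · exact hYB y hy
    · rw [Multiset.eq_of_mem_replicate hy]; exact hN
  · rw [Multiset.sum_add, Multiset.sum_replicate, smul_eq_mul, mul_comm i N, ← hi]
    omega

/-- A set `B` of positive integers has an arithmetic progression of length `2 m` and step at most
`max B / |B|` among the sums of few of its elements. -/
theorem exists_progression_of_few_summands (B : Finset ℕ) (hne : B.Nonempty) (m g : ℕ)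
    (hB : ∀ b ∈ B, 0 < b ∧ b ≤ g) (hgm : g ≤ 2 * m) :
    ∃ d a : ℕ, 0 < d ∧ d * B.card ≤ g ∧ (a + 2 * m * d) * B.card ≤ 14 * m * g ∧
      ∀ i : ℕ, 1 ≤ i → i ≤ 2 * m →
        ∃ Y : Multiset ℕ, (∀ y ∈ Y, y ∈ B) ∧ card Y * B.card ≤ 28 * m ∧ Y.sum = a + i * d := by
  classical
  set d := B.gcd id with hd
  set M := B.max' hne with hM
  have hMB : M ∈ B := B.max'_mem hne
  have hM0 := hB M hMB
  have hd0 : 0 < d := by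
    rw [Nat.pos_iff_ne_zero]
    intro h0
    have := Finset.gcd_eq_zero_iff.1 h0 M hMB
    simp only [id] at this
    omega
  have hdvd : ∀ b ∈ B, d ∣ b := fun b hb => Finset.gcd_dvd (f := id) hb
  set B' := B.image (· / d) with hB'
  have hcard : B'.card = B.card := by
    apply Finset.card_image_of_injOn
    intro a ha b hb hab
    exact (Nat.div_left_inj (hdvd a ha) (hdvd b hb)).1 hab
  set N := M / d with hN
  have hdN : d * N = M := Nat.mul_div_cancel' (hdvd M hMB)
  have hBb : ∀ b ∈ B', 0 < b ∧ b ≤ N := by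
    intro b hb
    obtain ⟨c, hc, rfl⟩ := Finset.mem_image.1 hb
    exact ⟨Nat.div_pos (Nat.le_of_dvd (hB c hc).1 (hdvd c hc)) hd0,
      Nat.div_le_div_right (B.le_max' c hc)⟩
  have hNB : N ∈ B' := Finset.mem_image_of_mem _ hMB
  have hN0 : 0 < N := (hBb N hNB).1
  have hBN : B.card ≤ N := by
    rw [← hcard]
    calc B'.card ≤ (Finset.Icc 1 N).card := Finset.card_le_card fun b hb => by
          have := hBb b hb
          simp; omega
      _ = N := by simp
  have hNM : N ≤ M := Nat.div_le_self _ _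
  have hc0 : 0 < B.card := hne.card_pos
  have hgcd : ∀ p : ℕ, p.Prime → ¬ ∀ b ∈ B', p ∣ b := by
    intro p hp hall
    have h1 : d * p ∣ d := by
      apply Finset.dvd_gcd
      intro b hb
      have := hall (b / d) (Finset.mem_image_of_mem _ hb)
      obtain ⟨c, hc⟩ := this
      exact ⟨c, by rw [id, mul_assoc, ← hc, Nat.mul_div_cancel' (hdvd b hb)]⟩
    have h2 := Nat.le_of_dvd hd0 h1
    have h3 := hp.two_le
    nlinarith
  set j := 2 * N / B.card + 1 with hj
  have hj1 : 2 * N < j * B'.card := by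
    rw [hcard, hj, mul_comm _ B.card]
    exact Nat.lt_mul_div_succ _ hc0
  have hj2 : j * B.card ≤ 3 * N := by
    have := Nat.div_mul_le_self (2 * N) B.card
    rw [hj, add_mul]; omega
  set q := 2 * m / N with hq
  have hq1 : q * N ≤ 2 * m := Nat.div_mul_le_self _ _
  have hq2 : 2 * m < (q + 1) * N := by
    rw [mul_comm _ N]; exact Nat.lt_mul_div_succ _ hN0
  refine ⟨d, 2 * j * N * d, hd0, ?_, ?_, ?_⟩
  · calc d * B.card ≤ d * N := Nat.mul_le_mul_left _ hBN
      _ ≤ g := by rw [hdN]; exact hM0.2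
  · calc (2 * j * N * d + 2 * m * d) * B.card
        = 2 * (d * N) * (j * B.card) + 2 * m * (d * B.card) := by ring
      _ ≤ 2 * (d * N) * (3 * (2 * m)) + 2 * m * (d * N) := by
          have : j * B.card ≤ 3 * (2 * m) := by omega
          exact Nat.add_le_add (Nat.mul_le_mul_left _ this)
            (Nat.mul_le_mul_left _ (Nat.mul_le_mul_left _ hBN))
      _ = 14 * m * (d * N) := by ring
      _ ≤ 14 * m * g := by rw [hdN]; gcongr; exact hM0.2
  · intro i hi1 hi2
    obtain ⟨Y, hYB, hYc, hYs⟩ := exists_bounded_sum_of_coprime B' N hNB hBb hgcd j hj1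
      (2 * j + (q + 1)) (2 * j * N + i) (by omega) (by rw [add_mul]; omega)
    refine ⟨Y.map (d * ·), ?_, ?_, ?_⟩
    · intro y hy
      obtain ⟨z, hz, rfl⟩ := Multiset.mem_map.1 hy
      obtain ⟨b, hb, rfl⟩ := Finset.mem_image.1 (hYB z hz)
      simpa only [Nat.mul_div_cancel' (hdvd b hb)] using hb
    · rw [Multiset.card_map]
      calc card Y * B.card ≤ (2 * j + (2 * j + (q + 1))) * B.card := Nat.mul_le_mul_right _ hYc
        _ = 4 * (j * B.card) + q * B.card + B.card := by ring
        _ ≤ 4 * (3 * N) + q * N + N := by gcongr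
        _ ≤ 28 * m := by omega
    · rw [Multiset.sum_map_mul_left, Multiset.map_id', hYs]; ring

/-- If every `z ∈ Z` is a sum of two elements of `D` in at least `v` ways and `Z` is small, then
the sum of `Z` is a subset sum of the multiset containing each element of `D` exactly `k` times. -/
theorem exists_le_nsmul_of_many_representations (D : Finset ℕ) (k v : ℕ) (hk : 0 < k)
    (Z : Multiset ℕ)
    (hZ : ∀ z ∈ Z, v ≤ ((D ×ˢ D).filter fun p => p.1 + p.2 = z).card)
    (hv : 8 * card Z ≤ v * k) :
    ∃ Y ≤ k • D.val, card Y = 2 * card Z ∧ Y.sum = Z.sum := by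
  classical
  induction Z using Multiset.induction_on with
  | empty => exact ⟨0, by simp, by simp, by simp⟩
  | cons z Z ih =>
    rw [Multiset.card_cons] at hv
    obtain ⟨Y, hYD, hYc, hYs⟩ := ih (fun z hz => hZ z (Multiset.mem_cons_of_mem hz)) (by omega)
    set E := D.filter fun x => k ≤ 2 * Y.count x with hE
    have hEk : k * E.card ≤ 4 * card Z := by
      have h1 : ∑ x ∈ E, k ≤ ∑ x ∈ E, 2 * Y.count x :=
        Finset.sum_le_sum fun x hx => (Finset.mem_filter.1 hx).2
      rw [Finset.sum_const, smul_eq_mul, ← Finset.mul_sum] at h1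
      have h2 : ∑ x ∈ E, Y.count x ≤ card Y := by
        rw [← Multiset.toFinset_sum_count_eq Y]
        apply Finset.sum_le_sum_of_ne_zero
        intro x _ hx
        rw [Multiset.mem_toFinset]
        exact Multiset.count_ne_zero.1 hx
      rw [mul_comm]; omega
    set P := (D ×ˢ D).filter fun p => p.1 + p.2 = z with hP
    have hPv : v ≤ P.card := hZ z (Multiset.mem_cons_self z Z)
    have hb1 : (P.filter fun p => p.1 ∈ E).card ≤ E.card := by
      apply Finset.card_le_card_of_injOn Prod.fst
      · intro p hp; exact (Finset.mem_filter.1 hp).2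
      · rintro ⟨a, b⟩ hp ⟨a', b'⟩ hp' h
        simp [hP] at hp hp' h ⊢
        omega
    have hb2 : (P.filter fun p => p.2 ∈ E).card ≤ E.card := by
      apply Finset.card_le_card_of_injOn Prod.snd
      · intro p hp; exact (Finset.mem_filter.1 hp).2
      · rintro ⟨a, b⟩ hp ⟨a', b'⟩ hp' h
        simp [hP] at hp hp' h ⊢
        omega
    have hb3 : (P.filter fun p => p.1 = p.2).card ≤ 1 := by
      rw [Finset.card_le_one]
      rintro ⟨a, b⟩ hp ⟨a', b'⟩ hp'
      simp [hP] at hp hp' ⊢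
      omega
    have hgood : ∃ p ∈ P, p.1 ∉ E ∧ p.2 ∉ E ∧ (k = 1 → p.1 ≠ p.2) := by
      by_contra! hbad
      by_cases hk1 : k = 1
      · have : P ⊆ (P.filter fun p => p.1 ∈ E) ∪ (P.filter fun p => p.2 ∈ E) ∪
            (P.filter fun p => p.1 = p.2) := by
          intro p hp
          have := hbad p hp
          simp only [Finset.mem_union, Finset.mem_filter, hp, true_and]
          tauto
        have h1 := Finset.card_le_card this
        have h2 := Finset.card_union_le ((P.filter fun p => p.1 ∈ E) ∪
          (P.filter fun p => p.2 ∈ E)) (P.filter fun p => p.1 = p.2)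
        have h3 := Finset.card_union_le (P.filter fun p => p.1 ∈ E) (P.filter fun p => p.2 ∈ E)
        subst hk1
        omega
      · have : P ⊆ (P.filter fun p => p.1 ∈ E) ∪ (P.filter fun p => p.2 ∈ E) := by
          intro p hp
          have := hbad p hp
          simp only [Finset.mem_union, Finset.mem_filter, hp, true_and]
          tauto
        have h1 := Finset.card_le_card this
        have h3 := Finset.card_union_le (P.filter fun p => p.1 ∈ E) (P.filter fun p => p.2 ∈ E)
        have h4 : v * k ≤ 2 * E.card * k := Nat.mul_le_mul_right _ (by omega)
        have h5 : 2 * E.card * k = 2 * (k * E.card) := by ring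
        omega
    obtain ⟨⟨a, b⟩, hp, ha, hb, hab⟩ := hgood
    simp only [hP, Finset.mem_filter, Finset.mem_product] at hp
    obtain ⟨⟨haD, hbD⟩, hz⟩ := hp
    simp only [hE, Finset.mem_filter, haD, hbD, true_and, not_le] at ha hb
    refine ⟨a ::ₘ b ::ₘ Y, ?_, by simp [hYc]; ring, by simp [hYs, ← hz, add_assoc]⟩
    rw [Multiset.le_iff_count] at hYD ⊢
    intro x
    have hx := hYD x
    have hD1 : ∀ y ∈ D, D.val.count y = 1 := fun y hy =>
      Multiset.count_eq_one_of_mem D.nodup hy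
    rw [Multiset.count_nsmul] at hx ⊢
    simp only [Multiset.count_cons]
    by_cases hxa : x = a <;> by_cases hxb : x = b
    · subst hxa
      subst hxb
      rw [hD1 x haD]
      simp only [if_true]
      have : k ≠ 1 := fun h => hab h rfl
      omega
    · subst hxa
      rw [hD1 x haD]
      simp [hxb]; omega
    · subst hxb
      rw [hD1 x hbD]
      simp [hxa]; omega
    · simpa [hxa, hxb] using hx

theorem sum_inv_Icc_le_logb (M : ℕ) (hM : 0 < M) :
    ∑ i ∈ Finset.Icc 1 M, ((i : ℝ))⁻¹ ≤ Real.logb 2 (2 * M) := by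
  have h1 := harmonic_le_one_add_log M
  rw [harmonic_eq_sum_Icc] at h1
  push_cast at h1
  have hM' : (1 : ℝ) ≤ M := by exact_mod_cast hM
  rw [Real.logb_mul (by norm_num) (by positivity), Real.logb_self_eq_one (by norm_num)]
  have h2 : Real.log M ≤ Real.logb 2 M := by
    rw [Real.logb, le_div_iff₀ (Real.log_pos (by norm_num))]
    have := Real.log_nonneg hM'
    have := Real.log_two_lt_d9
    nlinarith
  linarith

theorem exists_sum_le_mul_logb (f : ℕ → ℕ) (M : ℕ) (hM : 0 < M) :
    ∃ k : ℕ, 1 ≤ k ∧ k ≤ M ∧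
      ((∑ i ∈ Finset.Icc 1 M, f i : ℕ) : ℝ) ≤ k * f k * Real.logb 2 (2 * M) := by
  by_contra! hcon
  set L := Real.logb 2 (2 * M) with hL
  set S : ℝ := ((∑ i ∈ Finset.Icc 1 M, f i : ℕ) : ℝ) with hS
  have hsum := sum_inv_Icc_le_logb M hM
  rw [← hL] at hsum
  have hS0 : 0 ≤ S := Nat.cast_nonneg _
  have h1 : S * L < S * ∑ i ∈ Finset.Icc 1 M, ((i : ℝ))⁻¹ := by
    conv_lhs => rw [hS]
    push_cast
    rw [Finset.sum_mul, Finset.mul_sum]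
    apply Finset.sum_lt_sum_of_nonempty ⟨1, by simp; omega⟩
    intro i hi
    rw [Finset.mem_Icc] at hi
    have hi0 : (0 : ℝ) < i := by exact_mod_cast hi.1
    rw [← div_eq_mul_inv, lt_div_iff₀ hi0]
    have := hcon i hi.1 hi.2
    linarith
  nlinarith

/-- Some level set of the multiplicity function carries a logarithmic proportion of a multiset. -/
theorem exists_large_multiplicity_level (A : Multiset ℕ) (M : ℕ) (hM : 0 < M)
    (hA : ∀ x, A.count x ≤ M) :
    ∃ k : ℕ, 1 ≤ k ∧ k ≤ M ∧ ∃ D : Finset ℕ, k • D.val ≤ A ∧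
      (card A : ℝ) ≤ k * D.card * Real.logb 2 (2 * M) := by
  obtain ⟨k, hk1, hkM, hk⟩ := exists_sum_le_mul_logb
    (fun i => (A.toFinset.filter fun x => i ≤ A.count x).card) M hM
  refine ⟨k, hk1, hkM, A.toFinset.filter fun x => k ≤ A.count x, ?_, ?_⟩
  · rw [Multiset.le_iff_count]
    intro x
    rw [Multiset.count_nsmul]
    by_cases hx : x ∈ A.toFinset.filter fun x => k ≤ A.count x
    · rw [Multiset.count_eq_one_of_mem (Finset.nodup _) hx, mul_one]
      exact (Finset.mem_filter.1 hx).2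
    · rw [Multiset.count_eq_zero_of_notMem hx]; simp
  · convert hk using 2
    rw [← Multiset.toFinset_sum_count_eq]
    simp only [Finset.card_filter]
    rw [Finset.sum_comm]
    apply Finset.sum_congr rfl
    intro x _
    rw [← Finset.card_filter]
    have : (Finset.Icc 1 M).filter (fun i => i ≤ A.count x) = Finset.Icc 1 (A.count x) := by
      ext i
      have := hA x
      simp only [Finset.mem_filter, Finset.mem_Icc]
      omega
    rw [this]; simp

/-- A popular level of the representation function of `D + D` that contains at least `|D| / 2`
elements. -/
theorem exists_popular_sums (D : Finset ℕ) (hD : D.Nonempty) :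
    ∃ v : ℕ, ∃ B : Finset ℕ, D.card ≤ 2 * B.card ∧
      (∀ z ∈ B, v ≤ ((D ×ˢ D).filter fun p => p.1 + p.2 = z).card) ∧
      (∀ z ∈ B, ∃ a ∈ D, ∃ b ∈ D, a + b = z) ∧
      ((D.card : ℝ)) ^ 2 ≤ 2 * v * B.card * Real.logb 2 (2 * D.card) := by
  classical
  set r : ℕ → ℕ := fun z => ((D ×ˢ D).filter fun p => p.1 + p.2 = z).card with hr
  set S := (D ×ˢ D).image fun p => p.1 + p.2 with hS
  set B : ℕ → Finset ℕ := fun v => S.filter fun z => v ≤ r z with hB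
  have hD0 := hD.card_pos
  have hrle : ∀ z, r z ≤ D.card := by
    intro z
    apply Finset.card_le_card_of_injOn Prod.fst
    · intro p hp
      exact (Finset.mem_product.1 (Finset.mem_filter.1 hp).1).1
    · rintro ⟨a, b⟩ hp ⟨a', b'⟩ hp' h
      simp at hp hp' h ⊢
      omega
  have htotal : ∑ v ∈ Finset.Icc 1 D.card, (B v).card = D.card ^ 2 := by
    simp only [hB, Finset.card_filter]
    rw [Finset.sum_comm]
    have h1 : ∀ z ∈ S, (∑ v ∈ Finset.Icc 1 D.card, if v ≤ r z then 1 else 0) = r z := by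
      intro z _
      rw [← Finset.card_filter]
      have : (Finset.Icc 1 D.card).filter (fun v => v ≤ r z) = Finset.Icc 1 (r z) := by
        ext i
        have := hrle z
        simp only [Finset.mem_filter, Finset.mem_Icc]
        omega
      rw [this]; simp
    rw [Finset.sum_congr rfl h1, pow_two, ← Finset.card_product]
    exact (Finset.card_eq_sum_card_image (fun p : ℕ × ℕ => p.1 + p.2) (D ×ˢ D)).symm
  obtain ⟨v, hv1, hvD, hv⟩ := exists_sum_le_mul_logb
    (fun v => if D.card ≤ 2 * (B v).card then (B v).card else 0) D.card hD0
  have hlow : D.card ^ 2 ≤ 2 * ∑ v ∈ Finset.Icc 1 D.card,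
      if D.card ≤ 2 * (B v).card then (B v).card else 0 := by
    have h2 : 2 * ∑ v ∈ Finset.Icc 1 D.card, (B v).card ≤ ∑ v ∈ Finset.Icc 1 D.card,
        (2 * (if D.card ≤ 2 * (B v).card then (B v).card else 0) + D.card) := by
      rw [Finset.mul_sum]
      apply Finset.sum_le_sum
      intro v _
      split_ifs <;> omega
    rw [htotal, Finset.sum_add_distrib, ← Finset.mul_sum, Finset.sum_const, Nat.card_Icc,
      smul_eq_mul, Nat.add_sub_cancel, ← pow_two] at h2
    omega
  have hlow' : ((D.card : ℝ)) ^ 2 ≤ 2 * ((∑ v ∈ Finset.Icc 1 D.card,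
      if D.card ≤ 2 * (B v).card then (B v).card else 0 : ℕ) : ℝ) := by exact_mod_cast hlow
  by_cases hbig : D.card ≤ 2 * (B v).card
  · refine ⟨v, B v, hbig, fun z hz => (Finset.mem_filter.1 hz).2, ?_, ?_⟩
    · intro z hz
      obtain ⟨p, hp, hpz⟩ := Finset.mem_image.1 (Finset.mem_filter.1 hz).1
      exact ⟨p.1, (Finset.mem_product.1 hp).1, p.2, (Finset.mem_product.1 hp).2, hpz⟩
    · rw [if_pos hbig] at hv
      linarith
  · rw [if_neg hbig] at hv
    have : (0 : ℝ) < (D.card : ℝ) ^ 2 := by positivity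
    simp only [Nat.cast_zero, mul_zero, zero_mul] at hv
    linarith

theorem Nat.card_primeFactors_le_log (x : ℕ) : x.primeFactors.card ≤ Nat.log 2 x := by
  rcases Nat.eq_zero_or_pos x with rfl | hx
  · simp
  apply Nat.le_log_of_pow_le (by norm_num)
  calc 2 ^ x.primeFactors.card ≤ ∏ p ∈ x.primeFactors, p :=
        Finset.pow_card_le_prod _ _ _ fun p hp => (Nat.prime_of_mem_primeFactors hp).two_le
    _ ≤ x := Nat.le_of_dvd hx (Nat.prod_primeFactors_dvd x)

theorem Multiset.exists_le_card_eq {α : Type*} {s : Multiset α} {n : ℕ} (h : n ≤ card s) :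
    ∃ t ≤ s, card t = n := by
  induction s using Quotient.inductionOn with
  | h l => exact ⟨(l.take n : List α), (List.take_sublist n l).subperm, by simpa using h⟩

/-- A small sub-multiset inheriting, for each prime, many elements not divisible by it. -/
theorem exists_small_le_with_nonmultiples (X : Multiset ℕ) (hpos : ∀ x ∈ X, 0 < x) (m K : ℕ)
    (hm : ∀ x ∈ X, x ≤ m) (hK : 2 * K ≤ card X)
    (hnd : ∀ p : ℕ, p.Prime → K ≤ card (X.filter fun x => ¬ p ∣ x)) :
    ∃ R ≤ X, (∀ p : ℕ, p.Prime → K ≤ card (R.filter fun x => ¬ p ∣ x)) ∧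
      card R ≤ 2 * K * (1 + Nat.log 2 m) := by
  obtain ⟨R₀, hR₀X, hR₀c⟩ := Multiset.exists_le_card_eq hK
  set P : Finset ℕ := (R₀.toFinset.biUnion Nat.primeFactors).filter
    fun p => card (R₀.filter fun x => ¬ p ∣ x) < K with hP
  have hPcard : P.card * K ≤ 2 * K * Nat.log 2 m := by
    have h1 : ∀ p ∈ P, K ≤ card (R₀.filter fun x => p ∣ x) := by
      intro p hp
      have h2 := (Finset.mem_filter.1 hp).2
      have h3 := congrArg card (Multiset.filter_add_not (fun x => p ∣ x) R₀)
      rw [Multiset.card_add] at h3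
      omega
    have h4 : ∀ R : Multiset ℕ, R ≤ X → ∑ p ∈ P, card (R.filter fun x => p ∣ x) ≤
        card R * Nat.log 2 m := by
      intro R
      induction R using Multiset.induction_on with
      | empty => simp
      | cons x R ih =>
        intro hR
        have hx : x ∈ X := Multiset.mem_of_le hR (Multiset.mem_cons_self x R)
        have hRX := ih ((Multiset.le_cons_self R x).trans hR)
        have h5 : ∀ p, card ((x ::ₘ R).filter fun x => p ∣ x) =
            (if p ∣ x then 1 else 0) + card (R.filter fun x => p ∣ x) := by
          intro p
          rw [Multiset.filter_cons, Multiset.card_add]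
          split_ifs <;> simp
        simp only [h5]
        rw [Finset.sum_add_distrib, ← Finset.card_filter, Multiset.card_cons, add_mul, one_mul]
        have h6 : (P.filter fun p => p ∣ x).card ≤ Nat.log 2 m := by
          calc (P.filter fun p => p ∣ x).card ≤ x.primeFactors.card := by
                apply Finset.card_le_card
                intro p hp
                rw [Finset.mem_filter] at hp
                obtain ⟨y, -, hy⟩ := Finset.mem_biUnion.1 (Finset.mem_filter.1 hp.1).1
                exact Nat.mem_primeFactors.2
                  ⟨Nat.prime_of_mem_primeFactors hy, hp.2, (hpos x hx).ne'⟩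
            _ ≤ Nat.log 2 x := Nat.card_primeFactors_le_log x
            _ ≤ Nat.log 2 m := Nat.log_mono_right (hm x hx)
        omega
    calc P.card * K = ∑ p ∈ P, K := by simp
      _ ≤ ∑ p ∈ P, card (R₀.filter fun x => p ∣ x) := Finset.sum_le_sum h1
      _ ≤ card R₀ * Nat.log 2 m := h4 R₀ hR₀X
      _ = 2 * K * Nat.log 2 m := by rw [hR₀c]
  have hext : ∀ Q : Finset ℕ, (∀ p ∈ Q, p.Prime) → ∃ R ≤ X, R₀ ≤ R ∧
      (∀ p ∈ Q, K ≤ card (R.filter fun x => ¬ p ∣ x)) ∧ card R ≤ 2 * K + Q.card * K := by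
    intro Q
    induction Q using Finset.induction_on with
    | empty => exact fun _ => ⟨R₀, hR₀X, le_rfl, by simp, by simp [hR₀c]⟩
    | insert p Q hpQ ih =>
      intro hQ
      obtain ⟨R, hRX, hR₀R, hRQ, hRc⟩ := ih fun q hq => hQ q (Finset.mem_insert_of_mem hq)
      obtain ⟨T, hTX, hTc⟩ := Multiset.exists_le_card_eq
        (hnd p (hQ p (Finset.mem_insert_self p Q)))
      have hTp : T.filter (fun x => ¬ p ∣ x) = T := Multiset.filter_eq_self.2 fun x hx =>
        (Multiset.mem_filter.1 (Multiset.mem_of_le hTX hx)).2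
      refine ⟨R ∪ T, Multiset.union_le hRX (hTX.trans (Multiset.filter_le _ _)),
        hR₀R.trans Multiset.le_union_left, ?_, ?_⟩
      · intro q hq
        rcases Finset.mem_insert.1 hq with rfl | hq
        · calc K = card (T.filter fun x => ¬ q ∣ x) := by rw [hTp, hTc]
            _ ≤ _ := Multiset.card_le_card (Multiset.filter_le_filter _ Multiset.le_union_right)
        · exact (hRQ q hq).trans
            (Multiset.card_le_card (Multiset.filter_le_filter _ Multiset.le_union_left))
      · have := Multiset.card_le_card (Multiset.union_le_add R T)
        rw [Multiset.card_add] at this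
        rw [Finset.card_insert_of_notMem hpQ, add_mul]
        omega
  obtain ⟨R, hRX, hR₀R, hRP, hRc⟩ := hext P fun p hp => by
    obtain ⟨y, -, hy⟩ := Finset.mem_biUnion.1 (Finset.mem_filter.1 hp).1
    exact Nat.prime_of_mem_primeFactors hy
  refine ⟨R, hRX, ?_, by rw [mul_add, mul_one]; omega⟩
  intro p hp
  by_cases hpP : p ∈ P
  · exact hRP p hpP
  · by_contra! hlt
    apply hpP
    have hlt₀ : card (R₀.filter fun x => ¬ p ∣ x) < K :=
      (Multiset.card_le_card (Multiset.filter_le_filter _ hR₀R)).trans_lt hlt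
    refine Finset.mem_filter.2 ⟨?_, hlt₀⟩
    have : ∃ x ∈ R₀, p ∣ x := by
      by_contra! hno
      rw [Multiset.filter_eq_self.2 hno] at hlt₀
      omega
    obtain ⟨x, hx, hpx⟩ := this
    exact Finset.mem_biUnion.2 ⟨x, Multiset.mem_toFinset.2 hx, Nat.mem_primeFactors.2
      ⟨hp, hpx, (hpos x (Multiset.mem_of_le hR₀X hx)).ne'⟩⟩

open scoped Pointwise in
theorem exists_subsetSums_mod_eq (R : Multiset ℕ) (s : ℕ) (hs : 0 < s)
    (hR : ∀ p : ℕ, p.Prime → p ∣ s → s ≤ card (R.filter fun x => ¬ p ∣ x)) (r : ℕ) (hr : r < s) :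
    ∃ u ∈ subsetSums R, u % s = r := by
  classical
  have : NeZero s := ⟨hs.ne'⟩
  set F : Multiset ℕ → Finset (ZMod s) :=
    fun Y => (Y.powerset.map fun T => (T.sum : ZMod s)).toFinset with hF
  have hmem : ∀ Y z, z ∈ F Y ↔ ∃ T ≤ Y, (T.sum : ZMod s) = z := by
    intro Y z
    simp [hF]
  have hmono : ∀ Y Y', Y ≤ Y' → F Y ⊆ F Y' := by
    intro Y Y' h z hz
    obtain ⟨T, hT, rfl⟩ := (hmem _ _).1 hz
    exact (hmem _ _).2 ⟨T, hT.trans h, rfl⟩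
  obtain ⟨Y, hY, hYmax⟩ := Finset.exists_max_image
    (R.powerset.toFinset.filter fun Y => card Y + 1 ≤ (F Y).card) card
    ⟨0, by simp [hF]⟩
  simp only [Finset.mem_filter, Multiset.mem_toFinset, Multiset.mem_powerset] at hY hYmax
  by_cases huniv : F Y = Finset.univ
  · have : (r : ZMod s) ∈ F Y := by rw [huniv]; simp
    obtain ⟨T, hT, hTr⟩ := (hmem _ _).1 this
    refine ⟨T.sum, ⟨T, hT.trans hY.1, rfl⟩, ?_⟩
    have h := (ZMod.natCast_eq_natCast_iff _ _ _).1 hTr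
    rw [Nat.ModEq, Nat.mod_eq_of_lt hr] at h
    exact h
  · exfalso
    have hlt : (F Y).card < s := by
      have := (Finset.card_lt_iff_ne_univ (F Y)).2 huniv
      rwa [ZMod.card] at this
    set H := AddAction.stabilizer (ZMod s) (F Y) with hH
    have h0 : (0 : ZMod s) ∈ F Y := (hmem _ _).2 ⟨0, by simp, by simp⟩
    have hne : H ≠ ⊤ := by
      intro htop
      apply huniv
      apply Finset.eq_univ_of_forall
      intro z
      have hz : z ∈ H := by rw [htop]; trivial
      rw [hH, AddAction.mem_stabilizer_iff] at hz
      rw [← hz]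
      exact Finset.mem_vadd_finset.2 ⟨0, h0, by simp⟩
    obtain ⟨p, hp, hps, hdvd⟩ := exists_prime_dvd_of_addSubgroup_ne_top H hne
    have hall : ∀ x ∈ R - Y, p ∣ x := by
      intro x hx
      apply hdvd
      have hle : x ::ₘ Y ≤ R := by
        have := Multiset.singleton_le.2 hx
        calc x ::ₘ Y = {x} + Y := rfl
          _ ≤ (R - Y) + Y := by gcongr
          _ = R := Multiset.sub_add_cancel hY.1
      have hcard : (F (x ::ₘ Y)).card ≤ (F Y).card := by
        by_contra! hgt
        have := hYmax _ ⟨hle, by rw [Multiset.card_cons]; omega⟩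
        rw [Multiset.card_cons] at this
        omega
      have hEq := Finset.eq_of_subset_of_card_le (hmono _ _ (Multiset.le_cons_self Y x)) hcard
      rw [hH, AddAction.mem_stabilizer_iff]
      apply Finset.eq_of_subset_of_card_le _ (by simp)
      intro z hz
      obtain ⟨y, hy, rfl⟩ := Finset.mem_vadd_finset.1 hz
      obtain ⟨T, hT, rfl⟩ := (hmem _ _).1 hy
      rw [hEq]
      exact (hmem _ _).2 ⟨x ::ₘ T, Multiset.cons_le_cons x hT, by simp⟩
    have h1 := hR p hp hps
    rw [← Multiset.sub_add_cancel hY.1, Multiset.filter_add, Multiset.card_add,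
      Multiset.filter_eq_nil.2 (by simpa using hall)] at h1
    have h2 := Multiset.card_le_card (Multiset.filter_le (fun x => ¬ p ∣ x) Y)
    simp only [Multiset.card_zero, zero_add] at h1
    omega

theorem subsetSums_mono {A B : Multiset ℕ} (h : A ≤ B) : subsetSums A ⊆ subsetSums B := by
  rintro _ ⟨Y, hY, rfl⟩
  exact ⟨Y, hY.trans h, rfl⟩

/-- Subset sums of a dense uniform multiset contain a long arithmetic progression. -/
theorem exists_progression_in_subsetSums (D : Finset ℕ) (hD : D.Nonempty) (k n m l : ℕ)
    (hk : 0 < k) (hDl : ∀ x ∈ D, 0 < x ∧ x ≤ l) (hlm : l ≤ m) (hDn : D.card ≤ n)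
    (hdense : 448 * m * Real.logb 2 (2 * n) ≤ k * (D.card : ℝ) ^ 2) :
    ∃ d a : ℕ, 0 < d ∧ d * D.card ≤ 4 * l ∧ (a + 2 * m * d) * D.card ≤ 56 * m * l ∧
      ∀ i : ℕ, 1 ≤ i → i ≤ 2 * m → a + i * d ∈ subsetSums (k • D.val) := by
  obtain ⟨v, B, hBD, hBv, hBs, hpop⟩ := exists_popular_sums D hD
  have hD0 := hD.card_pos
  have hB0 : 0 < B.card := by omega
  have hBl : ∀ b ∈ B, 0 < b ∧ b ≤ 2 * l := by
    intro z hz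
    obtain ⟨a, ha, b, hb, rfl⟩ := hBs z hz
    have := hDl a ha
    have := hDl b hb
    omega
  have hmany : 224 * m ≤ v * k * B.card := by
    have hD1 : (1 : ℝ) ≤ D.card := by exact_mod_cast hD0
    have hDn' : (D.card : ℝ) ≤ n := by exact_mod_cast hDn
    have hlog : Real.logb 2 (2 * D.card) ≤ Real.logb 2 (2 * n) :=
      Real.logb_le_logb_of_le (by norm_num) (by positivity) (by linarith)
    have hlog0 : 0 < Real.logb 2 (2 * n) := Real.logb_pos (by norm_num) (by linarith)
    have h1 : (k : ℝ) * (D.card : ℝ) ^ 2 ≤ 2 * (v * k * B.card) * Real.logb 2 (2 * n) := by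
      calc (k : ℝ) * (D.card : ℝ) ^ 2 ≤ k * (2 * v * B.card * Real.logb 2 (2 * D.card)) := by
            gcongr
        _ ≤ k * (2 * v * B.card * Real.logb 2 (2 * n)) := by gcongr
        _ = _ := by ring
    have h2 : (448 * m : ℝ) ≤ 2 * (v * k * B.card) :=
      le_of_mul_le_mul_right (hdense.trans h1) hlog0
    have h3 : (224 * m : ℝ) ≤ v * k * B.card := by linarith
    exact_mod_cast h3
  obtain ⟨d, a, hd0, hd, ha, hap⟩ := exists_progression_of_few_summands B
    (Finset.card_pos.1 hB0) m (2 * l) hBl (by omega)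
  refine ⟨d, a, hd0, ?_, ?_, ?_⟩
  · calc d * D.card ≤ d * (2 * B.card) := Nat.mul_le_mul_left _ hBD
      _ = 2 * (d * B.card) := by ring
      _ ≤ 4 * l := by omega
  · calc (a + 2 * m * d) * D.card ≤ (a + 2 * m * d) * (2 * B.card) := Nat.mul_le_mul_left _ hBD
      _ = 2 * ((a + 2 * m * d) * B.card) := by ring
      _ ≤ 2 * (14 * m * (2 * l)) := Nat.mul_le_mul_left _ ha
      _ = 56 * m * l := by ring
  · intro i hi1 hi2
    obtain ⟨Z, hZB, hZc, hZs⟩ := hap i hi1 hi2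
    have hvk : 8 * card Z ≤ v * k := by
      apply Nat.le_of_mul_le_mul_right _ hB0
      calc 8 * card Z * B.card = 8 * (card Z * B.card) := by ring
        _ ≤ v * k * B.card := by omega
    obtain ⟨Y, hYD, -, hYs⟩ := exists_le_nsmul_of_many_representations D k v hk Z
      (fun z hz => hBv z (hZB z hz)) hvk
    exact ⟨Y, hYD, by rw [hYs, hZs]⟩

theorem one_le_logb_two_mul (a : ℕ) (ha : 0 < a) : 1 ≤ Real.logb 2 (2 * a) := by
  have h : (1 : ℝ) ≤ a := by exact_mod_cast ha
  rw [Real.le_logb_iff_rpow_le (by norm_num) (by positivity), Real.rpow_one]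
  linarith

theorem one_add_natLog_le (m n : ℕ) (hm : 0 < m) (hn : 0 < n) (hmn : m ≤ n ^ 2) :
    (1 + Nat.log 2 m : ℝ) ≤ 2 * Real.logb 2 (2 * n) := by
  have hm' : (0 : ℝ) < m := by exact_mod_cast hm
  have hn' : (0 : ℝ) < n := by exact_mod_cast hn
  have h1 : (Nat.log 2 m : ℝ) ≤ Real.logb 2 m := by exact_mod_cast Real.natLog_le_logb m 2
  have h2 : Real.logb 2 m ≤ Real.logb 2 ((n : ℝ) ^ 2) :=
    Real.logb_le_logb_of_le (by norm_num) hm' (by exact_mod_cast hmn)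
  rw [Real.logb_pow] at h2
  rw [Real.logb_mul (by norm_num) hn'.ne', Real.logb_self_eq_one (by norm_num)]
  push_cast at h2
  linarith

/-- At most half of the elements of a multiset exceed twice its average. -/
theorem two_mul_card_filter_large_le (X : Multiset ℕ) (hX : 0 < X.sum) :
    2 * card (X.filter fun x => ¬ x * card X ≤ 2 * X.sum) ≤ card X := by
  set Y := X.filter fun x => ¬ x * card X ≤ 2 * X.sum with hY
  have h1 : card Y * (2 * X.sum) ≤ (Y.map (· * card X)).sum := by
    have := Multiset.card_nsmul_le_sum (s := Y.map (· * card X)) (a := 2 * X.sum) (by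
      intro y hy
      obtain ⟨x, hx, rfl⟩ := Multiset.mem_map.1 hy
      exact (not_le.1 (Multiset.mem_filter.1 hx).2).le)
    simpa using this
  rw [Multiset.sum_map_mul_right, Multiset.map_id'] at h1
  have h2 : Y.sum ≤ X.sum := by
    obtain ⟨Z, hZ⟩ := Multiset.le_iff_exists_add.1
      (Multiset.filter_le (fun x => ¬ x * card X ≤ 2 * X.sum) X)
    have := congrArg Multiset.sum hZ
    rw [Multiset.sum_add, ← hY] at this
    omega
  have h3 : 2 * card Y * X.sum ≤ card X * X.sum := by nlinarith
  exact Nat.le_of_mul_le_mul_right h3 hX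


theorem stmt15 (X : Multiset ℕ) (hX : X ≠ 0) (hpos : ∀ x ∈ X, 0 < x)
    (n : ℕ) (hn : n = Multiset.card X)
    (hdense : DenseMS (1699200 * Real.logb 2 (2 * n) * (Real.logb 2 (2 * maxMul X)) ^ 2) X)
    (hnad : ∀ d : ℕ, ¬ AlmostDivisor (42480 * Real.logb 2 (2 * maxMul X)) X d) :
    ∃ R A G : Multiset ℕ, X = R + A + G ∧
      ∃ s : ℕ, 0 < s ∧
        (s : ℝ) ≤ 42480 * maxMul X * X.sum * Real.logb 2 (2 * maxMul X) / (n : ℝ) ^ 2 ∧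
        (∀ r : ℕ, r < s → ∃ u ∈ subsetSums R, u % s = r) ∧
        (∃ a : ℕ,
          (∀ i : ℕ, 1 ≤ i → i ≤ 2 * mxElt X → a + i * s ∈ subsetSums A) ∧
          ((a + 2 * mxElt X * s : ℕ) : ℝ) ≤
            84960 * maxMul X * mxElt X * X.sum * Real.logb 2 (2 * maxMul X) / (n : ℝ) ^ 2) ∧
        (X.sum : ℝ) / 2 ≤ (G.sum : ℝ) := by
  have hcount : ∀ x, X.count x ≤ maxMul X := by
    intro x
    by_cases hx : x ∈ X
    · exact Finset.le_sup (f := fun x => X.count x) (Multiset.mem_toFinset.2 hx)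
    · rw [Multiset.count_eq_zero_of_notMem hx]; exact Nat.zero_le _
  have hmx : ∀ x ∈ X, x ≤ mxElt X := fun x hx => Multiset.le_sup hx
  obtain ⟨x₀, hx₀⟩ := Multiset.exists_mem_of_ne_zero hX
  have hμ0 : 0 < maxMul X := (Multiset.count_pos.2 hx₀).trans_le (hcount x₀)
  have hm0 : 0 < mxElt X := (hpos x₀ hx₀).trans_le (hmx x₀ hx₀)
  have hn0 : 0 < n := hn ▸ Multiset.card_pos.2 hX
  have hS0 : 0 < X.sum := (hpos x₀ hx₀).trans_le (Multiset.le_sum_of_mem hx₀)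
  have hSm : X.sum ≤ n * mxElt X := by
    have := Multiset.sum_le_card_nsmul X (mxElt X) hmx
    simpa [← hn] using this
  unfold DenseMS at hdense
  unfold AlmostDivisor at hnad
  rw [← hn] at hdense
  simp only [← hn, not_and, not_le] at hnad
  have hLo := one_le_logb_two_mul _ hμ0
  have hΛo := one_le_logb_two_mul _ hn0
  set μ := maxMul X
  set m := mxElt X
  set L := Real.logb 2 (2 * μ) with hL
  set Λ := Real.logb 2 (2 * n) with hΛ
  have hμ1 : (1 : ℝ) ≤ μ := by exact_mod_cast hμ0
  have hm1 : (1 : ℝ) ≤ m := by exact_mod_cast hm0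
  have hn1 : (1 : ℝ) ≤ n := by exact_mod_cast hn0
  have hS1 : (1 : ℝ) ≤ X.sum := by exact_mod_cast hS0
  have hSm' : (X.sum : ℝ) ≤ n * m := by exact_mod_cast hSm
  have hn2 : (0 : ℝ) < (n : ℝ) ^ 2 := by positivity
  have hmn' : 1699200 * (m : ℝ) ≤ (n : ℝ) ^ 2 := by
    have h1 : 1 ≤ Λ * L ^ 2 * μ :=
      one_le_mul_of_one_le_of_one_le
        (one_le_mul_of_one_le_of_one_le hΛo (one_le_pow₀ hLo)) hμ1
    nlinarith
  have hmn : m ≤ n ^ 2 := by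
    have : (m : ℝ) ≤ (n : ℝ) ^ 2 := by linarith
    exact_mod_cast this
  have hn1000 : 1000 ≤ n := by
    have : (1000 : ℝ) ≤ n := by nlinarith
    exact_mod_cast this
  set T : ℝ := 42480 * L * μ * X.sum / (n : ℝ) ^ 2 with hT
  have hT0 : 0 ≤ T := by positivity
  have hTn : T * (n : ℝ) ^ 2 = 42480 * L * μ * X.sum := by
    rw [hT]; field_simp
  have hTm : 40 * Λ * (T * m) ≤ X.sum := by
    have h1 : 1699200 * Λ * L * μ * m ≤ (n : ℝ) ^ 2 := by
      refine le_trans ?_ hdense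
      have h2 : L ≤ L ^ 2 := by nlinarith
      calc 1699200 * Λ * L * μ * m ≤ 1699200 * Λ * L ^ 2 * μ * m := by gcongr
        _ = _ := by ring
    have h3 : (n : ℝ) ^ 2 * (40 * Λ * (T * m)) ≤ (n : ℝ) ^ 2 * X.sum := by
      calc (n : ℝ) ^ 2 * (40 * Λ * (T * m)) = 40 * Λ * m * (T * (n : ℝ) ^ 2) := by ring
        _ = (1699200 * Λ * L * μ * m) * X.sum := by rw [hTn]; ring
        _ ≤ _ := by gcongr
    exact le_of_mul_le_mul_left h3 hn2
  have hTm' : 40 * (T * m) ≤ X.sum := by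
    have : 0 ≤ T * m := by positivity
    nlinarith
  set K := ⌊T⌋₊ with hK
  have hKT : (K : ℝ) ≤ T := Nat.floor_le hT0
  have hKn : 2 * K ≤ n := by
    have h1 : 40 * T * m ≤ n * m := by linarith
    have h2 : 40 * T ≤ n := le_of_mul_le_mul_right h1 (by linarith)
    have : (2 * K : ℝ) ≤ n := by linarith
    exact_mod_cast this
  obtain ⟨R, hRX, hRp, hRc⟩ := exists_small_le_with_nonmultiples X hpos m K hmx (hn ▸ hKn)
    fun p hp => Nat.floor_le_of_le (hnad p hp.one_lt).le
  have hRm : 10 * ((card R : ℝ) * m) ≤ X.sum := by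
    have h1 : (card R : ℝ) ≤ 2 * K * (1 + Nat.log 2 m) := by exact_mod_cast hRc
    have h2 : (card R : ℝ) ≤ 2 * T * (2 * Λ) := by
      refine h1.trans ?_
      have := one_add_natLog_le m n hm0 hn0 hmn
      gcongr
    calc 10 * ((card R : ℝ) * m) ≤ 10 * ((2 * T * (2 * Λ)) * m) := by gcongr
      _ = 40 * Λ * (T * m) := by ring
      _ ≤ X.sum := hTm
  have hRn : 10 * card R ≤ n := by
    have h1 : 10 * (card R : ℝ) * m ≤ n * m := by linarith
    have h2 : 10 * (card R : ℝ) ≤ n := le_of_mul_le_mul_right h1 (by linarith)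
    exact_mod_cast h2
  have hRsum : 10 * (R.sum : ℝ) ≤ X.sum := by
    have h1 : R.sum ≤ card R * m := by
      have := Multiset.sum_le_card_nsmul R m fun x hx => hmx x (Multiset.mem_of_le hRX hx)
      simpa using this
    have h2 : (R.sum : ℝ) ≤ card R * m := by exact_mod_cast h1
    linarith
  have hsmall : n / 5 ≤ card ((X - R).filter fun x => x * n ≤ 2 * X.sum) := by
    have h1 := two_mul_card_filter_large_le X hS0
    rw [← hn] at h1
    have h2 := congrArg card
      (Multiset.filter_add_not (fun x => x * n ≤ 2 * X.sum) (X - R))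
    have h3 : card ((X - R).filter fun x => ¬ x * n ≤ 2 * X.sum) ≤
        card (X.filter fun x => ¬ x * n ≤ 2 * X.sum) :=
      Multiset.card_le_card (Multiset.filter_le_filter _ (Multiset.sub_le_self X R))
    rw [Multiset.card_add, Multiset.card_sub hRX, ← hn] at h2
    omega
  obtain ⟨A, hAle, hAc⟩ := Multiset.exists_le_card_eq hsmall
  have hAXR : A ≤ X - R := hAle.trans (Multiset.filter_le _ _)
  have hAX : A ≤ X := hAXR.trans (Multiset.sub_le_self X R)
  set l := min (2 * X.sum / n) m with hl
  have hAl : ∀ x ∈ A, 0 < x ∧ x ≤ l := by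
    intro x hx
    refine ⟨hpos x (Multiset.mem_of_le hAX hx),
      le_min ?_ (hmx x (Multiset.mem_of_le hAX hx))⟩
    exact (Nat.le_div_iff_mul_le hn0).2 (Multiset.mem_filter.1 (Multiset.mem_of_le hAle hx)).2
  have hln : l * n ≤ 2 * X.sum :=
    (Nat.mul_le_mul_right n (min_le_left _ _)).trans (Nat.div_mul_le_self _ _)
  have hAsum : 5 * A.sum ≤ 2 * X.sum := by
    have h1 := Multiset.sum_le_card_nsmul A l fun x hx => (hAl x hx).2
    rw [hAc, smul_eq_mul] at h1
    calc 5 * A.sum ≤ 5 * (n / 5 * l) := Nat.mul_le_mul_left 5 h1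
      _ = 5 * (n / 5) * l := by ring
      _ ≤ n * l := Nat.mul_le_mul_right _ (Nat.mul_div_le n 5)
      _ ≤ 2 * X.sum := by rw [mul_comm]; exact hln
  obtain ⟨k, hk1, hkμ, D, hDA, hDk⟩ := exists_large_multiplicity_level A μ hμ0
    fun x => (Multiset.count_le_of_le x hAX).trans (hcount x)
  rw [← hL] at hDk
  have hnD : (n : ℝ) ≤ 6 * (k * D.card * L) := by
    have h1 : n ≤ 6 * card A := by omega
    have h2 : (n : ℝ) ≤ 6 * card A := by exact_mod_cast h1
    linarith
  have hDne : D.Nonempty := by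
    rw [Finset.nonempty_iff_ne_empty]
    rintro rfl
    simp at hnD
    linarith
  have hDA' : D.val ≤ A := by
    refine le_trans ?_ hDA
    calc D.val = 1 • D.val := (one_nsmul _).symm
      _ ≤ k • D.val := nsmul_le_nsmul_left (Multiset.zero_le _) hk1
  have hDn : D.card ≤ n := hn ▸ Multiset.card_le_card (hDA'.trans hAX)
  have hk1' : (1 : ℝ) ≤ k := by exact_mod_cast hk1
  have hkμ' : (k : ℝ) ≤ μ := by exact_mod_cast hkμ
  have hDdense : 448 * m * Λ ≤ k * (D.card : ℝ) ^ 2 := by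
    have h1 : (n : ℝ) ^ 2 ≤ (6 * (k * D.card * L)) ^ 2 := by gcongr
    have h2 : (k * L ^ 2) * (1699200 * Λ * m) ≤ (k * L ^ 2) * (36 * (k * (D.card : ℝ) ^ 2)) := by
      calc (k * L ^ 2) * (1699200 * Λ * m) ≤ (μ * L ^ 2) * (1699200 * Λ * m) := by gcongr
        _ = 1699200 * Λ * L ^ 2 * μ * m := by ring
        _ ≤ (6 * (k * D.card * L)) ^ 2 := hdense.trans h1
        _ = _ := by ring
    have h3 := le_of_mul_le_mul_left h2 (by positivity)
    have h4 : 0 ≤ Λ * m := by positivity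
    linarith
  obtain ⟨s, a, hs0, hs, ha, hap⟩ := exists_progression_in_subsetSums D hDne k n m l hk1
    (fun x hx => hAl x (Multiset.mem_of_le hDA' hx)) (min_le_right _ _) hDn hDdense
  have hscale : ∀ y c : ℕ, y * D.card ≤ c * l →
      (y : ℝ) * (n : ℝ) ^ 2 ≤ 12 * c * (μ * L * X.sum) := by
    intro y c hyc
    have h1 : (y : ℝ) * D.card ≤ c * l := by exact_mod_cast hyc
    have h2 : (l : ℝ) * n ≤ 2 * X.sum := by exact_mod_cast hln
    calc (y : ℝ) * (n : ℝ) ^ 2 = y * n * n := by ring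
      _ ≤ y * (6 * (k * D.card * L)) * n := by gcongr
      _ = 6 * k * L * n * (y * D.card) := by ring
      _ ≤ 6 * k * L * n * (c * l) := by gcongr
      _ = 6 * k * L * c * (l * n) := by ring
      _ ≤ 6 * μ * L * c * (2 * X.sum) := by gcongr
      _ = _ := by ring
  have hPos : 0 ≤ μ * L * X.sum := by positivity
  have hsT : (s : ℝ) ≤ 42480 * μ * X.sum * L / (n : ℝ) ^ 2 := by
    rw [le_div_iff₀ hn2]
    have := hscale s 4 hs
    rw [Nat.cast_ofNat] at this
    linarith
  have hsK : s ≤ K := Nat.le_floor (hsT.trans_eq (by rw [hT]; ring))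
  refine ⟨R, A, X - R - A, ?_, s, hs0, hsT, ?_, ⟨a, ?_, ?_⟩, ?_⟩
  · rw [add_assoc, add_tsub_cancel_of_le hAXR, add_tsub_cancel_of_le hRX]
  · exact fun r hr => exists_subsetSums_mod_eq R s hs0 (fun p hp _ => hsK.trans (hRp p hp)) r hr
  · exact fun i hi1 hi2 => subsetSums_mono hDA (hap i hi1 hi2)
  · rw [le_div_iff₀ hn2]
    have := hscale (a + 2 * m * s) (56 * m) ha
    simp only [Nat.cast_mul, Nat.cast_add, Nat.cast_ofNat] at this ⊢
    have h1 : 0 ≤ m * (μ * L * X.sum) := by positivity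
    linarith
  · have h1 : X.sum = R.sum + A.sum + (X - R - A).sum := by
      rw [← Multiset.sum_add, ← Multiset.sum_add, add_assoc, add_tsub_cancel_of_le hAXR,
        add_tsub_cancel_of_le hRX]
    have h2 : (X.sum : ℝ) = R.sum + A.sum + (X - R - A).sum := by exact_mod_cast h1
    have h3 : 5 * (A.sum : ℝ) ≤ 2 * X.sum := by exact_mod_cast hAsum
    linarith
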